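/- Fix x ∈ ℝ, let h = 1_{(−∞,x]}, let Z be standard normal, and let f_x be the bounded solution of the Stein equation for h, with f_x'(w) := w f_x(w) + 1_{(−∞,x]}(w) − P(Z ≤ x). Then for all w, u, v ∈ ℝ: |f_x'(w) − f_x'(v)| ≤ 1 and |(w+u)f_x(w+u) − (w+v)f_x(w+v)| ≤ (|w| + √(2π)/4)(|u| + |v|). -/

import Mathlib

open MeasureTheory ProbabilityTheory Real

section GaussTail

open Set Filter Topology

/-- The unnormalised Gaussian tail `∫_w^∞ exp (-t² / 2) dt`. -/
noncomputable def gaussTail (w : ℝ) : ℝ := ∫ t in Ioi w, exp (-(t ^ 2) / 2)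

/-- Mills' ratio `exp (w² / 2) ∫_w^∞ exp (-t² / 2) dt` of the standard Gaussian. -/
noncomputable def millsRatio (w : ℝ) : ℝ := exp (w ^ 2 / 2) * gaussTail w

lemma nonneg_of_deriv_nonpos_of_tendsto_zero {D D' : ℝ → ℝ} {a : ℝ}
    (hD : ∀ y, a ≤ y → HasDerivAt D (D' y) y) (hD' : ∀ y, a ≤ y → D' y ≤ 0)
    (hlim : Tendsto D atTop (𝓝 0)) : 0 ≤ D a := by
  have hanti : AntitoneOn D (Ici a) := by
    refine antitoneOn_of_deriv_nonpos (convex_Ici a)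
      (fun y hy => (hD y hy).continuousAt.continuousWithinAt)
      (fun y hy => (hD y (interior_subset hy)).differentiableAt.differentiableWithinAt) ?_
    intro y hy
    rw [(hD y (interior_subset hy)).deriv]
    exact hD' y (interior_subset hy)
  refine le_of_tendsto hlim ?_
  filter_upwards [eventually_ge_atTop a] with y hy
  exact hanti self_mem_Ici hy hy

lemma integrable_exp_neg_sq_div_two : Integrable fun t : ℝ => exp (-(t ^ 2) / 2) := by
  convert integrable_exp_neg_mul_sq (b := 1 / 2) (by norm_num) using 3
  ring

lemma gaussTail_eq_sub (w : ℝ) :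
    gaussTail w = gaussTail 0 - ∫ t in (0 : ℝ)..w, exp (-(t ^ 2) / 2) := by
  have := intervalIntegral.integral_interval_add_Ioi
    (integrable_exp_neg_sq_div_two.integrableOn (s := Ioi 0))
    (integrable_exp_neg_sq_div_two.integrableOn (s := Ioi w))
  unfold gaussTail
  linarith

lemma hasDerivAt_gaussTail (w : ℝ) : HasDerivAt gaussTail (-exp (-(w ^ 2) / 2)) w := by
  have hc : Continuous fun t : ℝ => exp (-(t ^ 2) / 2) := by fun_prop
  have h := (hc.integral_hasStrictDerivAt 0 w).hasDerivAt.const_sub (gaussTail 0)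
  rwa [← funext gaussTail_eq_sub] at h

lemma tendsto_gaussTail_atTop : Tendsto gaussTail atTop (𝓝 0) := by
  have h := (intervalIntegral_tendsto_integral_Ioi 0
    (integrable_exp_neg_sq_div_two.integrableOn (s := Ioi 0)) tendsto_id).const_sub (gaussTail 0)
  have e : gaussTail 0 - ∫ t in Ioi (0 : ℝ), exp (-(t ^ 2) / 2) = 0 := sub_self _
  rw [e] at h
  exact h.congr fun w => (gaussTail_eq_sub w).symm

lemma gaussTail_nonneg (w : ℝ) : 0 ≤ gaussTail w :=
  integral_nonneg fun _ => (exp_pos _).le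

lemma integral_Iic_exp_neg_sq_div_two (w : ℝ) :
    ∫ t in Iic w, exp (-(t ^ 2) / 2) = gaussTail (-w) := by
  rw [gaussTail, ← integral_comp_neg_Iic]
  simp only [even_two.neg_pow]

lemma gaussTail_add_gaussTail_neg (w : ℝ) : gaussTail w + gaussTail (-w) = √(2 * π) := by
  have h := intervalIntegral.integral_Iic_add_Ioi
    (integrable_exp_neg_sq_div_two.integrableOn (s := Iic w))
    (integrable_exp_neg_sq_div_two.integrableOn (s := Ioi w))
  have h2 : ∫ t : ℝ, exp (-(t ^ 2) / 2) = √(2 * π) := by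
    convert integral_gaussian (1 / 2) using 3
    · congr 1; ring
    · ring
  rw [integral_Iic_exp_neg_sq_div_two, h2] at h
  unfold gaussTail at h ⊢
  linarith

lemma hasDerivAt_exp_neg_sq_div_two (w : ℝ) :
    HasDerivAt (fun t : ℝ => exp (-(t ^ 2) / 2)) (-w * exp (-(w ^ 2) / 2)) w := by
  refine (((hasDerivAt_pow 2 w).fun_neg).div_const 2).exp.congr_deriv ?_
  push_cast
  ring

lemma tendsto_exp_neg_sq_div_two_atTop :
    Tendsto (fun t : ℝ => exp (-(t ^ 2) / 2)) atTop (𝓝 0) := by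
  have h : Tendsto (fun t : ℝ => t ^ 2 / 2) atTop atTop :=
    (tendsto_pow_atTop two_ne_zero).atTop_div_const two_pos
  refine (tendsto_exp_neg_atTop_nhds_zero.comp h).congr fun t => ?_
  simp [neg_div]

lemma mul_gaussTail_le (w : ℝ) : w * gaussTail w ≤ exp (-(w ^ 2) / 2) := by
  rcases le_or_gt w 0 with hw | hw
  · exact (mul_nonpos_of_nonpos_of_nonneg hw (gaussTail_nonneg w)).trans (exp_pos _).le
  have h : 0 ≤ exp (-(w ^ 2) / 2) / w - gaussTail w := by
    refine nonneg_of_deriv_nonpos_of_tendsto_zero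
      (D := fun y => exp (-(y ^ 2) / 2) / y - gaussTail y)
      (D' := fun y => -(exp (-(y ^ 2) / 2) / y ^ 2)) ?_ (fun y _ => neg_nonpos.2 (by positivity)) ?_
    · intro y hy
      have hy0 : y ≠ 0 := (hw.trans_le hy).ne'
      refine (((hasDerivAt_exp_neg_sq_div_two y).fun_div (hasDerivAt_id' y) hy0).fun_sub
        (hasDerivAt_gaussTail y)).congr_deriv ?_
      field_simp
      ring
    · simpa using (tendsto_exp_neg_sq_div_two_atTop.div_atTop tendsto_id).sub
        tendsto_gaussTail_atTop
  have h2 := mul_nonneg hw.le h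
  rw [mul_sub, mul_div_cancel₀ _ hw.ne'] at h2
  linarith

lemma mul_exp_le_gaussTail (w : ℝ) :
    w * exp (-(w ^ 2) / 2) ≤ (1 + w ^ 2) * gaussTail w := by
  have h : 0 ≤ gaussTail w - exp (-(w ^ 2) / 2) * (w / (1 + w ^ 2)) := by
    refine nonneg_of_deriv_nonpos_of_tendsto_zero
      (D := fun y => gaussTail y - exp (-(y ^ 2) / 2) * (y / (1 + y ^ 2)))
      (D' := fun y => -(2 * exp (-(y ^ 2) / 2) / (1 + y ^ 2) ^ 2)) ?_
      (fun y _ => neg_nonpos.2 (by positivity)) ?_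
    · intro y _
      have hy0 : 1 + y ^ 2 ≠ 0 := by positivity
      refine ((hasDerivAt_gaussTail y).fun_sub ((hasDerivAt_exp_neg_sq_div_two y).fun_mul
        ((hasDerivAt_id' y).fun_div ((hasDerivAt_pow 2 y).const_add 1) hy0))).congr_deriv ?_
      field_simp
      push_cast
      ring
    · have hb : Tendsto (fun y : ℝ => exp (-(y ^ 2) / 2) * (y / (1 + y ^ 2))) atTop (𝓝 0) := by
        refine squeeze_zero_norm (fun y => ?_) tendsto_exp_neg_sq_div_two_atTop
        rw [norm_mul, norm_of_nonneg (exp_pos _).le, norm_div, norm_eq_abs, norm_eq_abs,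
          abs_of_pos (by positivity : 0 < 1 + y ^ 2)]
        refine mul_le_of_le_one_right (exp_pos _).le ((div_le_one (by positivity)).2 ?_)
        nlinarith [sq_nonneg (|y| - 1), sq_abs y]
      simpa using tendsto_gaussTail_atTop.sub hb
  have hp : 0 < 1 + w ^ 2 := by positivity
  have h2 := mul_nonneg hp.le h
  have e : (1 + w ^ 2) * (exp (-(w ^ 2) / 2) * (w / (1 + w ^ 2))) = w * exp (-(w ^ 2) / 2) := by
    field_simp
  rw [mul_sub, e] at h2
  linarith

lemma exp_mul_exp_neg_sq_div_two (w : ℝ) : exp (w ^ 2 / 2) * exp (-(w ^ 2) / 2) = 1 := by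
  rw [← exp_add, exp_eq_one_iff]
  ring

lemma millsRatio_nonneg (w : ℝ) : 0 ≤ millsRatio w :=
  mul_nonneg (exp_pos _).le (gaussTail_nonneg w)

lemma mul_millsRatio_le_one (w : ℝ) : w * millsRatio w ≤ 1 := by
  have h := mul_le_mul_of_nonneg_left (mul_gaussTail_le w) (exp_pos (w ^ 2 / 2)).le
  rw [exp_mul_exp_neg_sq_div_two] at h
  unfold millsRatio
  linarith

lemma hasDerivAt_millsRatio (w : ℝ) : HasDerivAt millsRatio (w * millsRatio w - 1) w := by
  have h := (((hasDerivAt_pow 2 w).div_const 2).exp).mul (hasDerivAt_gaussTail w)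
  refine h.congr_deriv ?_
  have := exp_mul_exp_neg_sq_div_two w
  rw [millsRatio]
  push_cast
  linear_combination -this

lemma antitone_millsRatio : Antitone millsRatio := by
  refine antitone_of_deriv_nonpos (fun w => (hasDerivAt_millsRatio w).differentiableAt) fun w => ?_
  rw [(hasDerivAt_millsRatio w).deriv]
  linarith [mul_millsRatio_le_one w]

lemma monotone_mul_millsRatio : Monotone fun w => w * millsRatio w := by
  have hd (w : ℝ) := (hasDerivAt_id' w).fun_mul (hasDerivAt_millsRatio w)
  refine monotone_of_deriv_nonneg (fun w => (hd w).differentiableAt) fun w => ?_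
  have h := mul_le_mul_of_nonneg_left (mul_exp_le_gaussTail w) (exp_pos (w ^ 2 / 2)).le
  have e := exp_mul_exp_neg_sq_div_two w
  refine (?_ : (0 : ℝ) ≤ _).trans_eq (hd w).deriv.symm
  simp only [millsRatio]
  linear_combination h - w * e

lemma gaussTail_mul_gaussTail_neg_le_of_nonneg {x : ℝ} (hx : 0 ≤ x) :
    gaussTail x * gaussTail (-x) ≤ π / 2 * exp (-(x ^ 2) / 2) := by
  set s := √(2 * π) with hs
  have hs2 : s ^ 2 = 2 * π := sq_sqrt (by positivity)
  have hneg (y : ℝ) : gaussTail (-y) = s - gaussTail y := by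
    linarith [gaussTail_add_gaussTail_neg y]
  have h0 : gaussTail 0 = s / 2 := by
    have := hneg 0
    rw [neg_zero] at this
    linarith
  rw [hneg]
  let T : ℝ → ℝ := fun y => π / 2 * exp (-(y ^ 2) / 2) - gaussTail y * (s - gaussTail y)
  let ψ : ℝ → ℝ := fun y => s - 2 * gaussTail y - y * (π / 2)
  have hT (y : ℝ) : HasDerivAt T (exp (-(y ^ 2) / 2) * ψ y) y := by
    refine (((hasDerivAt_exp_neg_sq_div_two y).const_mul (π / 2)).fun_sub
      ((hasDerivAt_gaussTail y).fun_mul ((hasDerivAt_gaussTail y).const_sub s))).congr_deriv ?_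
    simp only [ψ]
    ring
  have hψ (y : ℝ) : HasDerivAt ψ (2 * exp (-(y ^ 2) / 2) - π / 2) y := by
    refine ((((hasDerivAt_gaussTail y).const_mul 2).const_sub s).fun_sub
      ((hasDerivAt_id' y).mul_const (π / 2))).congr_deriv ?_
    ring
  have hconc : ConcaveOn ℝ (Ici 0) ψ := by
    refine AntitoneOn.concaveOn_of_deriv (convex_Ici 0)
      (fun y _ => (hψ y).continuousAt.continuousWithinAt)
      (fun y _ => (hψ y).differentiableAt.differentiableWithinAt) ?_
    intro a ha b _ hab
    rw [(hψ a).deriv, (hψ b).deriv]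
    have ha0 : 0 ≤ a := interior_subset ha
    gcongr
  have hψ0 : ψ 0 = 0 := by
    simp only [ψ, h0]
    ring
  have hnonneg_of_le {a b : ℝ} (ha : 0 ≤ a) (hab : a ≤ b) (hb : 0 ≤ ψ b) : 0 ≤ ψ a := by
    have := hconc.min_le_of_mem_Icc self_mem_Ici (ha.trans hab) ⟨ha, hab⟩
    rwa [hψ0, min_eq_left hb] at this
  have hTx : 0 ≤ T x := by
    rcases le_or_gt 0 (ψ x) with hp | hp
    · have hmono : MonotoneOn T (Icc 0 x) := by
        refine monotoneOn_of_deriv_nonneg (convex_Icc 0 x)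
          (fun y _ => (hT y).continuousAt.continuousWithinAt)
          (fun y _ => (hT y).differentiableAt.differentiableWithinAt) fun y hy => ?_
        rw [(hT y).deriv]
        have hy' := interior_subset hy
        exact mul_nonneg (exp_pos _).le (hnonneg_of_le hy'.1 hy'.2 hp)
      have h := hmono (left_mem_Icc.2 hx) (right_mem_Icc.2 hx) hx
      have hT0 : T 0 = 0 := by
        simp only [T, h0]
        norm_num
        linear_combination -hs2 / 4
      rwa [hT0] at h
    · refine nonneg_of_deriv_nonpos_of_tendsto_zero (fun y _ => hT y) (fun y hy => ?_) ?_
      · refine mul_nonpos_of_nonneg_of_nonpos (exp_pos _).le (le_of_not_gt fun hy' => ?_)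
        exact absurd (hnonneg_of_le hx hy hy'.le) hp.not_ge
      · simpa [T] using (tendsto_exp_neg_sq_div_two_atTop.const_mul (π / 2)).sub
          (tendsto_gaussTail_atTop.mul (tendsto_gaussTail_atTop.const_sub s))
  simpa [T] using hTx

lemma gaussTail_mul_gaussTail_neg_le (x : ℝ) :
    gaussTail x * gaussTail (-x) ≤ π / 2 * exp (-(x ^ 2) / 2) := by
  rcases le_total 0 x with hx | hx
  · exact gaussTail_mul_gaussTail_neg_le_of_nonneg hx
  · simpa [mul_comm] using gaussTail_mul_gaussTail_neg_le_of_nonneg (neg_nonneg.2 hx)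

lemma gaussianReal_Iic_toReal (x : ℝ) :
    ((gaussianReal 0 1) (Iic x)).toReal = gaussTail (-x) / √(2 * π) := by
  rw [gaussianReal_apply_eq_integral 0 one_ne_zero, ENNReal.toReal_ofReal
    (integral_nonneg fun t => gaussianPDFReal_nonneg 0 1 t), ← integral_Iic_exp_neg_sq_div_two]
  simp only [gaussianPDFReal, sub_zero, NNReal.coe_one, mul_one, integral_const_mul]
  ring

/-- A function which is `1`-Lipschitz by its derivative on each side of `x` is `1`-Lipschitz. -/
lemma abs_sub_le_of_hasDerivWithinAt_Iic_Ici {f f' : ℝ → ℝ} {x : ℝ}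
    (hl : ∀ w ∈ Iic x, HasDerivWithinAt f (f' w) (Iic x) w) (hl' : ∀ w ∈ Iic x, |f' w| ≤ 1)
    {g' : ℝ → ℝ}
    (hr : ∀ w ∈ Ici x, HasDerivWithinAt f (g' w) (Ici x) w) (hr' : ∀ w ∈ Ici x, |g' w| ≤ 1)
    (a b : ℝ) : |f a - f b| ≤ |a - b| := by
  have hL {a b : ℝ} (ha : a ∈ Iic x) (hb : b ∈ Iic x) : |f b - f a| ≤ |b - a| := by
    simpa using (convex_Iic x).norm_image_sub_le_of_norm_hasDerivWithin_le hl hl' ha hb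
  have hR {a b : ℝ} (ha : a ∈ Ici x) (hb : b ∈ Ici x) : |f b - f a| ≤ |b - a| := by
    simpa using (convex_Ici x).norm_image_sub_le_of_norm_hasDerivWithin_le hr hr' ha hb
  wlog hab : a ≤ b generalizing a b
  · rw [abs_sub_comm, abs_sub_comm a]
    exact this b a (le_of_not_ge hab)
  rw [abs_sub_comm, abs_sub_comm a]
  rcases le_total b x with hb | hb
  · exact hL (hab.trans hb) hb
  rcases le_total x a with ha | ha
  · exact hR ha (ha.trans hab)
  calc |f b - f a| ≤ |f b - f x| + |f x - f a| := abs_sub_le _ _ _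
    _ ≤ |b - x| + |x - a| := add_le_add (hR self_mem_Ici hb) (hL ha self_mem_Iic)
    _ = |b - a| := by
      rw [abs_of_nonneg (sub_nonneg.2 hb), abs_of_nonneg (sub_nonneg.2 ha),
        abs_of_nonneg (sub_nonneg.2 hab)]
      ring

lemma integral_Ioi_exp_mul_indicator_sub_of_ge {x w : ℝ} (hw : x ≤ w) (p : ℝ) :
    ∫ t in Ioi w, exp (-(t ^ 2) / 2) * ((if t ≤ x then (1 : ℝ) else 0) - p) =
      -p * gaussTail w := by
  rw [gaussTail, ← integral_const_mul]
  refine setIntegral_congr_fun measurableSet_Ioi fun t ht => ?_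
  simp only [if_neg (hw.trans_lt ht).not_ge]
  ring

lemma integral_Ioi_exp_mul_indicator_sub_of_le {x w : ℝ} (hw : w ≤ x) (p : ℝ) :
    ∫ t in Ioi w, exp (-(t ^ 2) / 2) * ((if t ≤ x then (1 : ℝ) else 0) - p) =
      (1 - p) * gaussTail w - gaussTail x := by
  have hsplit : ∀ t : ℝ, exp (-(t ^ 2) / 2) * ((if t ≤ x then (1 : ℝ) else 0) - p) =
      (1 - p) * exp (-(t ^ 2) / 2) - (Ioi x).indicator (fun t => exp (-(t ^ 2) / 2)) t := by
    intro t
    by_cases h : t ≤ x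
    · rw [indicator_of_notMem (by simpa using h), if_pos h]
      ring
    · rw [indicator_of_mem (by simpa using h), if_neg h]
      ring
  simp_rw [hsplit]
  rw [integral_sub (integrable_exp_neg_sq_div_two.integrableOn.const_mul _)
    (integrable_exp_neg_sq_div_two.indicator measurableSet_Ioi).integrableOn,
    integral_const_mul, setIntegral_indicator measurableSet_Ioi,
    inter_eq_self_of_subset_right (Ioi_subset_Ioi hw)]
  rfl

end GaussTail

/-- Further bounds for the solution `f_x` of the Stein equation with indicator
test function `h = 1_{(-∞, x]}`: with
`f_x'(w) := w f_x(w) + 1_{(-∞,x]}(w) - Φ(x)`, one has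
`|f_x'(w) - f_x'(v)| ≤ 1` for all `w, v`, and
`|(w+u) f_x(w+u) - (w+v) f_x(w+v)| ≤ (|w| + √(2π)/4)(|u| + |v|)`
for all `w, u, v`. -/
theorem stein_solution_indicator_bounds_two
    (x : ℝ)
    (Φ : ℝ) (hΦ : Φ = ((gaussianReal 0 1) (Set.Iic x)).toReal)
    (f : ℝ → ℝ)
    (hf : ∀ w, f w =
      -(Real.exp (w ^ 2 / 2)) *
        ∫ t in Set.Ioi w, Real.exp (-(t ^ 2) / 2) * ((if t ≤ x then (1 : ℝ) else 0) - Φ))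
    (f' : ℝ → ℝ)
    (hf' : ∀ w, f' w = w * f w + ((if w ≤ x then (1 : ℝ) else 0) - Φ)) :
    (∀ w v : ℝ, |f' w - f' v| ≤ 1) ∧
      (∀ w u v : ℝ,
        |(w + u) * f (w + u) - (w + v) * f (w + v)| ≤
          (|w| + Real.sqrt (2 * Real.pi) / 4) * (|u| + |v|)) := by
  set s := √(2 * π) with hs
  have hs0 : 0 < s := sqrt_pos.2 (by positivity)
  have hs2 : s ^ 2 = 2 * π := sq_sqrt (by positivity)
  have hadd := gaussTail_add_gaussTail_neg
  rw [gaussianReal_Iic_toReal, ← hs] at hΦ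
  set q := 1 - Φ with hq
  have hp : gaussTail (-x) = s * Φ := by rw [hΦ]; field_simp
  have hqx : gaussTail x = s * q := by rw [hq]; linarith [hadd x]
  have hp0 : 0 ≤ Φ := hΦ ▸ div_nonneg (gaussTail_nonneg _) hs0.le
  have hq0 : 0 ≤ q := nonneg_of_mul_nonneg_right (hqx ▸ gaussTail_nonneg x) hs0
  have hright : ∀ w, x ≤ w → f w = Φ * millsRatio w := by
    intro w hw
    rw [hf, integral_Ioi_exp_mul_indicator_sub_of_ge hw, millsRatio]
    ring
  have hleft : ∀ w, w ≤ x → f w = q * millsRatio (-w) := by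
    intro w hw
    rw [hf, integral_Ioi_exp_mul_indicator_sub_of_le hw, millsRatio, hqx, neg_sq, ← hq]
    linear_combination (-exp (w ^ 2 / 2) * q) * hadd w
  have hG1 := mul_millsRatio_le_one
  have hmonoR : MonotoneOn (fun w => w * f w) (Set.Ici x) := by
    intro a ha b hb hab
    have : Φ * (a * millsRatio a) ≤ Φ * (b * millsRatio b) :=
      mul_le_mul_of_nonneg_left (monotone_mul_millsRatio hab) hp0
    simp only [hright a ha, hright b hb]
    linarith
  have hmonoL : MonotoneOn (fun w => w * f w) (Set.Iic x) := by
    intro a ha b hb hab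
    have : q * (-b * millsRatio (-b)) ≤ q * (-a * millsRatio (-a)) :=
      mul_le_mul_of_nonneg_left (monotone_mul_millsRatio (neg_le_neg hab)) hq0
    simp only [hleft a ha, hleft b hb]
    linarith
  have hmono : Monotone fun w => w * f w := hmonoL.Iic_union_Ici hmonoR
  have hle : ∀ w, w * f w ≤ Φ := by
    intro w
    refine (hmono (le_max_left w x)).trans ?_
    simp only [hright _ (le_max_right w x)]
    linarith [mul_le_mul_of_nonneg_left (hG1 (max w x)) hp0]
  have hge : ∀ w, -q ≤ w * f w := by
    intro w
    refine le_trans ?_ (hmono (min_le_left w x))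
    simp only [hleft _ (min_le_right w x)]
    linarith [mul_le_mul_of_nonneg_left (hG1 (-min w x)) hq0]
  have hfx : f x ≤ s / 4 := by
    rw [hright x le_rfl, millsRatio]
    have h1 := mul_le_mul_of_nonneg_left (gaussTail_mul_gaussTail_neg_le x) (exp_pos (x ^ 2 / 2)).le
    have h2 := exp_mul_exp_neg_sq_div_two x
    rw [hp] at h1
    refine le_of_mul_le_mul_left ?_ hs0
    linear_combination h1 + π / 2 * h2 - hs2 / 4
  have hf0 : ∀ w, 0 ≤ f w := by
    intro w
    rcases le_total w x with hw | hw
    · exact hleft w hw ▸ mul_nonneg hq0 (millsRatio_nonneg _)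
    · exact hright w hw ▸ mul_nonneg hp0 (millsRatio_nonneg _)
  have hf4 : ∀ w, |f w| ≤ s / 4 := by
    intro w
    rw [abs_of_nonneg (hf0 w)]
    refine le_trans ?_ hfx
    rcases le_total w x with hw | hw
    · rw [hleft w hw, hleft x le_rfl]
      exact mul_le_mul_of_nonneg_left (antitone_millsRatio (neg_le_neg hw)) hq0
    · rw [hright w hw, hright x le_rfl]
      exact mul_le_mul_of_nonneg_left (antitone_millsRatio hw) hp0
  have hlip : ∀ a b, |f a - f b| ≤ |a - b| := by
    refine abs_sub_le_of_hasDerivWithinAt_Iic_Ici (x := x) (f' := fun w => w * f w + q)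
      (g' := fun w => w * f w - Φ) ?_ ?_ ?_ ?_
    · intro w hw
      have h := (((hasDerivAt_millsRatio (-w)).comp w (hasDerivAt_neg w)).const_mul
        q).hasDerivWithinAt (s := Set.Iic x)
      refine (h.congr (fun y hy => hleft y hy) (hleft w hw)).congr_deriv ?_
      rw [hleft w hw]
      ring
    · intro w _
      rw [abs_le]
      constructor <;> linarith [hle w, hge w]
    · intro w hw
      have h := ((hasDerivAt_millsRatio w).const_mul Φ).hasDerivWithinAt (s := Set.Ici x)
      refine (h.congr (fun y hy => hright y hy) (hright w hw)).congr_deriv ?_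
      rw [hright w hw]
      ring
    · intro w _
      rw [abs_le]
      constructor <;> linarith [hle w, hge w]
  refine ⟨fun w v => ?_, fun w u v => ?_⟩
  · have key : ∀ w, (w ≤ x → 0 ≤ f' w ∧ f' w ≤ x * f x + q) ∧
        (x < w → x * f x - Φ ≤ f' w ∧ f' w ≤ 0) := by
      intro w
      rw [hf']
      refine ⟨fun hw => ?_, fun hw => ?_⟩
      · have := hmono hw
        rw [if_pos hw]
        constructor <;> linarith [hge w]
      · have := hmono hw.le
        rw [if_neg hw.not_ge]
        constructor <;> linarith [hle w]
    have hx1 := hle x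
    have hx2 := hge x
    rw [abs_le]
    rcases le_or_gt w x with hw | hw <;> rcases le_or_gt v x with hv | hv
    · have h1 := (key w).1 hw
      have h2 := (key v).1 hv
      constructor <;> linarith
    · have h1 := (key w).1 hw
      have h2 := (key v).2 hv
      constructor <;> linarith
    · have h1 := (key w).2 hw
      have h2 := (key v).1 hv
      constructor <;> linarith
    · have h1 := (key w).2 hw
      have h2 := (key v).2 hv
      constructor <;> linarith
  · have hdiff : |f (w + u) - f (w + v)| ≤ |u| + |v| := by
      refine (hlip _ _).trans ?_
      rw [add_sub_add_left_eq_sub]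
      exact abs_sub u v
    calc |(w + u) * f (w + u) - (w + v) * f (w + v)|
        = |w * (f (w + u) - f (w + v)) + (u * f (w + u) - v * f (w + v))| := by ring_nf
      _ ≤ |w| * |f (w + u) - f (w + v)| + (|u| * |f (w + u)| + |v| * |f (w + v)|) := by
        simp only [← abs_mul]
        exact (abs_add_le _ _).trans (add_le_add le_rfl (abs_sub _ _))
      _ ≤ |w| * (|u| + |v|) + (|u| * (s / 4) + |v| * (s / 4)) := by
        gcongr
        · exact hf4 _
        · exact hf4 _
      _ = (|w| + s / 4) * (|u| + |v|) := by ring
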